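/- Let t be a positive integer, written t = 2t' or t = 2t'+1 according to parity, and let λ be a self-conjugate partition with Littlewood decomposition Ω(λ) = (λ̃, λ^0, ..., λ^{t-1}). Fix i ∈ {0, ..., t'-1}, let v = (j,k) be a box of λ^i, let v* = (k,j) be the corresponding box of λ^{t-1-i} = (λ^i)*, and let V and V* be the boxes of λ canonically associated with v and v* respectively. If V lies strictly above (respectively strictly below) the principal diagonal of λ, then V* lies strictly below (respectively strictly above) the principal diagonal of λ; in particular ε_V · ε_{V*} = -1. -/

import Mathlib

/-!
Statement 7 (Lemma `littlewood3` (iii)): let `t` be a positive integer (with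
`t = 2t'` or `t = 2t'+1` according to parity, i.e. `t' = t/2`), `λ` a
self-conjugate partition with Littlewood decomposition `Ω(λ) = (λ̃, λ⁰, …, λ^{t-1})`,
`i ∈ {0, …, t'-1}`, `v = (j,k)` a box of `λ^i` and `v* = (k,j)` the corresponding
box of `λ^{t-1-i} = (λ^i)*`, with `V`, `V*` the boxes of `λ` canonically
associated with `v`, `v*`. If `V` lies strictly above (resp. strictly below) the
principal diagonal of `λ`, then `V*` lies strictly below (resp. strictly above)
it; in particular `ε_V · ε_{V*} = -1`.

Encoding: a partition is encoded by its beta-set `S(λ) = {λ_i - i : i ≥ 1} ⊆ ℤ`;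
its boxes correspond to pairs `(a, b)`, `a ∈ S`, `b ∉ S`, `b < a`, with row
index `#{x ∈ S : x > a}` and column index `#{x ∉ S : x < b}`. The component
`λ^r` is encoded by `S_r = {m : t·m + r ∈ S}`; the box `(a,b)` of `λ^i`
corresponds to the box `V = (t·a+i, t·b+i)` of `λ`, and the conjugate box
`v* = (k,j)` of `λ^{t-1-i}` corresponds to the box `V* = (-1-(t·b+i), -1-(t·a+i))`
of `λ` (conjugation acting on beta-sets by `T ↦ -1 - Tᶜ`).
-/

noncomputable section

open scoped Classical

/-- The beta-set of a Young diagram: `{λ_{i+1} - (i+1) : i ≥ 0} ⊆ ℤ`. -/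
def betaSet (μ : YoungDiagram) : Set ℤ :=
  Set.range fun i : ℕ => (μ.rowLen i : ℤ) - i - 1

/-- The beta-set of the `r`-th component of the `t`-quotient of `μ`. -/
def quotSet (μ : YoungDiagram) (t r : ℕ) : Set ℤ :=
  {m : ℤ | (t : ℤ) * m + r ∈ betaSet μ}

/-- The row index of the box encoded by the pair `(a, _)`. -/
def rowIdx (T : Set ℤ) (a : ℤ) : ℕ :=
  Nat.card {x : ℤ // x ∈ T ∧ a < x}

/-- The column index of the box encoded by the pair `(_, b)`. -/
def colIdx (T : Set ℤ) (b : ℤ) : ℕ :=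
  Nat.card {x : ℤ // x ∉ T ∧ x < b}

/-- The box encoded by `(a, b)` lies strictly above the principal diagonal. -/
def aboveDiag (T : Set ℤ) (a b : ℤ) : Prop :=
  colIdx T b < rowIdx T a

/-- The box encoded by `(a, b)` lies strictly below the principal diagonal. -/
def belowDiag (T : Set ℤ) (a b : ℤ) : Prop :=
  rowIdx T a < colIdx T b

/-- `ε` of the box encoded by `(a, b)`: `-1` if strictly above the diagonal,
`1` otherwise. -/
def epsBox (T : Set ℤ) (a b : ℤ) : ℤ :=
  if aboveDiag T a b then -1 else 1

theorem aux_symm_mem (μ : YoungDiagram) (hsc : μ.transpose = μ) (i j : ℕ) :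
    j < μ.rowLen i ↔ i < μ.rowLen j := by
  rw [← YoungDiagram.mem_iff_lt_rowLen, ← YoungDiagram.mem_iff_lt_rowLen]
  conv_lhs => rw [← hsc]
  rw [YoungDiagram.mem_transpose]
  rfl

theorem aux_beta_symm (μ : YoungDiagram) (hsc : μ.transpose = μ) (x : ℤ) :
    x ∉ betaSet μ ↔ -1 - x ∈ betaSet μ := by
  have key := aux_symm_mem μ hsc
  constructor
  · intro hx
    have hex : ∃ i : ℕ, (μ.rowLen i : ℤ) ≤ i + x + 1 := by
      refine ⟨μ.rowLen 0 + x.natAbs, ?_⟩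
      have := μ.rowLen_anti 0 (μ.rowLen 0 + x.natAbs) (Nat.zero_le _)
      omega
    have h1 := Nat.find_spec hex
    have h2 := fun m => Nat.find_min hex (m := m)
    generalize Nat.find hex = i at h1 h2
    have hne : (μ.rowLen i : ℤ) ≠ i + x + 1 := by
      intro h
      exact hx ⟨i, by simp only; omega⟩
    obtain ⟨j, hj⟩ : ∃ j : ℕ, (j : ℤ) = i + x := ⟨(i + x).toNat, by omega⟩
    refine ⟨j, ?_⟩
    have k1 := key i j
    simp only
    rcases Nat.eq_zero_or_pos i with h0 | h0
    · omega
    · have h3 := h2 (i - 1) (by omega)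
      have k2 := key (i - 1) j
      omega
  · rintro ⟨i, hi⟩ ⟨j, hj⟩
    have k1 := key i j
    simp only at hi hj
    omega

theorem aux_col (μ : YoungDiagram) (hsc : μ.transpose = μ) (x : ℤ) :
    colIdx (betaSet μ) x = rowIdx (betaSet μ) (-1 - x) := by
  unfold colIdx rowIdx
  refine Nat.card_congr ((Equiv.subLeft (-1 : ℤ)).subtypeEquiv ?_)
  intro y
  rw [aux_beta_symm μ hsc]
  simp only [Equiv.subLeft_apply]
  constructor <;> rintro ⟨h, h'⟩ <;> exact ⟨h, by omega⟩

theorem aux_row_lt (μ : YoungDiagram) (x y : ℤ) (hy : y ∈ betaSet μ) (h : x < y) :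
    rowIdx (betaSet μ) y < rowIdx (betaSet μ) x := by
  have hf : {z : ℤ | z ∈ betaSet μ ∧ x < z}.Finite := by
    refine (Set.finite_Ioc x (μ.rowLen 0 : ℤ)).subset ?_
    rintro z ⟨⟨i, rfl⟩, hz⟩
    have := μ.rowLen_anti 0 i (Nat.zero_le _)
    refine ⟨hz, ?_⟩
    simp only
    omega
  refine Set.ncard_lt_ncard (s := {z : ℤ | z ∈ betaSet μ ∧ y < z}) ⟨?_, ?_⟩ hf
  · rintro z ⟨h1, h2⟩
    exact ⟨h1, h.trans h2⟩
  · intro hs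
    exact lt_irrefl y (hs ⟨hy, h⟩).2

theorem littlewood_SC_conjugate_boxes (t : ℕ) (ht : 0 < t) (μ : YoungDiagram)
    (hsc : μ.transpose = μ) (i : ℕ) (hi : i < t / 2)
    (a b : ℤ) (ha : a ∈ quotSet μ t i) (hb : b ∉ quotSet μ t i) (hba : b < a) :
    (aboveDiag (betaSet μ) ((t : ℤ) * a + i) ((t : ℤ) * b + i) →
      belowDiag (betaSet μ) (-1 - ((t : ℤ) * b + i)) (-1 - ((t : ℤ) * a + i))) ∧
    (belowDiag (betaSet μ) ((t : ℤ) * a + i) ((t : ℤ) * b + i) →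
      aboveDiag (betaSet μ) (-1 - ((t : ℤ) * b + i)) (-1 - ((t : ℤ) * a + i))) ∧
    epsBox (betaSet μ) ((t : ℤ) * a + i) ((t : ℤ) * b + i) *
      epsBox (betaSet μ) (-1 - ((t : ℤ) * b + i)) (-1 - ((t : ℤ) * a + i)) = -1 := by
  have hB := (aux_beta_symm μ hsc _).1 hb
  have hA : (t : ℤ) * a + i ∈ betaSet μ := ha
  have hne : (t : ℤ) * a + i ≠ -1 - ((t : ℤ) * b + i) := by
    intro h
    have h1 : (t : ℤ) * (-(a + b)) = 2 * i + 1 := by linarith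
    have h2 : (t : ℤ) ≤ 2 * i + 1 := Int.le_of_dvd (by omega) ⟨_, h1.symm⟩
    omega
  have hr : rowIdx (betaSet μ) ((t : ℤ) * a + i) ≠
      rowIdx (betaSet μ) (-1 - ((t : ℤ) * b + i)) := by
    rcases lt_or_gt_of_ne hne with h | h
    · exact (aux_row_lt μ _ _ hB h).ne'
    · exact (aux_row_lt μ _ _ hA h).ne
  unfold epsBox aboveDiag belowDiag
  rw [aux_col μ hsc, aux_col μ hsc, sub_sub_cancel]
  refine ⟨id, id, ?_⟩
  rcases lt_or_gt_of_ne hr with h | h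
  · rw [if_neg h.not_gt, if_pos h]; rfl
  · rw [if_pos h, if_neg h.not_gt]; rfl
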